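/- (McConnel's theorem) Let q = p^e be a prime power, let d be a divisor of q−1 with 1 < d < q−1, and let m = (q−1)/d. Then a function f : F_q → F_q satisfies f(0) = 0, f(1) = 1 and (f(u) − f(v))^m = (u − v)^m for all u, v ∈ F_q if and only if there exists a natural number j with d dividing p^j − 1 such that f(x) = x^{p^j} for all x ∈ F_q. -/

import Mathlib

/-- One digit of the theorem of Lucas, as a criterion for `p ∤ n.choose c`. -/
theorem not_dvd_choose_iff_mod_div {p : ℕ} (hp : p.Prime) (n c : ℕ) :
    ¬ p ∣ n.choose c ↔ c % p ≤ n % p ∧ ¬ p ∣ (n / p).choose (c / p) := by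
  have := Fact.mk hp
  have hlucas := Choose.choose_modEq_choose_mod_mul_choose_div_nat (n := n) (k := c) (p := p)
  rw [hlucas.dvd_iff dvd_rfl, hp.dvd_mul, not_or]
  refine and_congr_left fun _ => ⟨fun h => ?_, fun h hdvd => ?_⟩
  · by_contra! hlt
    exact h (by simp [Nat.choose_eq_zero_of_lt hlt])
  · have hmod : n % p < p := Nat.mod_lt _ hp.pos
    have : p ∣ (n % p).factorial := by
      rw [← Nat.choose_mul_factorial_mul_factorial h, mul_assoc]
      exact hdvd.mul_right _
    exact absurd ((hp.dvd_factorial).1 this) (by omega)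

theorem not_dvd_choose_of_mod_pow {p : ℕ} (hp : p.Prime) (j : ℕ) :
    ∀ n c : ℕ, ¬ p ∣ (n % p ^ j).choose c → ¬ p ∣ n.choose c := by
  induction j with
  | zero =>
    intro n c h
    rcases Nat.eq_zero_or_pos c with rfl | hc
    · simpa using hp.one_lt.ne'
    · exact absurd (by simp [Nat.mod_one, Nat.choose_eq_zero_of_lt hc]) h
  | succ j ih =>
    intro n c h
    rw [not_dvd_choose_iff_mod_div hp] at h ⊢
    rw [pow_succ', Nat.mod_mul_right_mod, Nat.mod_mul_right_div_self] at h
    exact ⟨h.1, ih _ _ h.2⟩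

theorem not_dvd_choose_pow_log {p : ℕ} (hp : p.Prime) (n : ℕ) (hn : n ≠ 0) :
    ¬ p ∣ n.choose (p ^ Nat.log p n) := by
  induction n using Nat.strong_induction_on with
  | _ n ih =>
    by_cases hlt : n < p
    · rw [Nat.log_of_lt hlt, pow_zero, Nat.choose_one_right]
      exact Nat.not_dvd_of_pos_of_lt (Nat.pos_of_ne_zero hn) hlt
    · push Not at hlt
      rw [Nat.log_of_one_lt_of_le hp.one_lt hlt, not_dvd_choose_iff_mod_div hp, pow_succ,
        Nat.mul_mod_left, Nat.mul_div_cancel _ hp.pos]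
      exact ⟨Nat.zero_le _, ih _ (Nat.div_lt_self (by omega) hp.one_lt)
        (Nat.div_pos hlt hp.pos).ne'⟩

/-- If `c < n` is dominated by `n` digitwise in base `p`, some digit of `c` can be raised by one. -/
theorem exists_not_dvd_choose_add_pow {p : ℕ} (hp : p.Prime) (n : ℕ) :
    ∀ c < n, ¬ p ∣ n.choose c → ∃ k, ¬ p ∣ n.choose (c + p ^ k) := by
  induction n using Nat.strong_induction_on with
  | _ n ih =>
    intro c hcn h
    rw [not_dvd_choose_iff_mod_div hp] at h
    by_cases hlt : c % p < n % p
    · refine ⟨0, (not_dvd_choose_iff_mod_div hp _ _).2 ?_⟩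
      have hmod : n % p < p := Nat.mod_lt _ hp.pos
      have h1 : (c + 1) % p = c % p + 1 := by
        rw [Nat.add_mod, Nat.mod_eq_of_lt (a := 1) hp.one_lt, Nat.mod_eq_of_lt (by omega)]
      have h2 : (c + 1) / p = c / p := by
        rw [Nat.add_div hp.pos, Nat.div_eq_of_lt hp.one_lt,
          Nat.mod_eq_of_lt (a := 1) hp.one_lt, if_neg (by omega)]
        rfl
      rw [pow_zero, h1, h2]
      exact ⟨hlt, h.2⟩
    · have hdiv : c / p < n / p := by
        have e1 := Nat.div_add_mod c p
        have e2 := Nat.div_add_mod n p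
        exact lt_of_mul_lt_mul_left (a := p) (by omega) (Nat.zero_le _)
      obtain ⟨k, hk⟩ := ih (n / p) (Nat.div_lt_self (by omega) hp.one_lt) _ hdiv h.2
      refine ⟨k + 1, (not_dvd_choose_iff_mod_div hp _ _).2 ?_⟩
      rw [pow_succ, Nat.add_mul_mod_self_right, Nat.add_mul_div_right _ _ hp.pos]
      exact ⟨h.1, hk⟩

/-- Raising the digits of `c` one at a time from the leading digit of `μ % p ^ j`, each step at most
doubles `c`, so the gap hypothesis `H` propagates up to `c = μ % p ^ j`. -/
theorem mul_mod_pow_le {p : ℕ} (hp : p.Prime) {Q μ σ j : ℕ} (hμ : 2 * μ < Q)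
    (hB : μ % p ^ j ≠ 0) (hj : σ * p ^ (j - 1) < Q)
    (H : ∀ c, ¬ p ∣ μ.choose c → c * σ < Q → c * σ ≤ μ) :
    (μ % p ^ j) * σ ≤ μ := by
  set B := μ % p ^ j with hBdef
  have hBlt : B < p ^ j := Nat.mod_lt _ (pow_pos hp.pos _)
  have good (c : ℕ) (hc : ¬ p ∣ B.choose c) : ¬ p ∣ μ.choose c :=
    not_dvd_choose_of_mod_pow hp j μ c hc
  have hlog : Nat.log p B ≤ j - 1 := by
    have := Nat.log_lt_of_lt_pow hB hBlt
    omega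
  have chain (r c : ℕ) (hr : B - c = r) (hcB : c ≤ B) (hlogc : p ^ Nat.log p B ≤ c)
      (hc : ¬ p ∣ B.choose c) (hcσ : c * σ ≤ μ) : B * σ ≤ μ := by
    induction r using Nat.strong_induction_on generalizing c with
    | _ r ih =>
      rcases hcB.eq_or_lt with rfl | hlt
      · exact hcσ
      obtain ⟨k, hk⟩ := exists_not_dvd_choose_add_pow hp B c hlt hc
      have hle : c + p ^ k ≤ B := by
        by_contra! h
        exact hk (by simp [Nat.choose_eq_zero_of_lt h])
      have hpk : p ^ k ≤ c :=
        (Nat.pow_le_pow_right hp.pos (Nat.le_log_of_pow_le hp.one_lt (by omega))).trans hlogc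
      have hpos : 0 < p ^ k := pow_pos hp.pos _
      refine ih (B - (c + p ^ k)) (by omega) _ rfl hle (by omega) hk (H _ (good _ hk) ?_)
      have : p ^ k * σ ≤ c * σ := Nat.mul_le_mul_right _ hpk
      rw [add_mul]
      omega
  refine chain _ _ rfl (Nat.pow_log_le_self p hB) le_rfl (not_dvd_choose_pow_log hp B hB)
    (H _ (good _ (not_dvd_choose_pow_log hp B hB)) ?_)
  refine lt_of_le_of_lt ?_ hj
  rw [mul_comm]
  exact Nat.mul_le_mul_left _ (Nat.pow_le_pow_right hp.pos hlog)

theorem not_dvd_of_mul_add_one_eq_pow {p d μ g : ℕ} (hp : p.Prime) (hg : g ≠ 0)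
    (hμ : d * μ + 1 = p ^ g) : ¬ p ∣ μ := fun h => by
  have h1 : p ∣ d * μ + 1 := hμ ▸ dvd_pow_self p hg
  exact hp.one_lt.ne' (Nat.dvd_one.1 ((Nat.dvd_add_right (h.mul_left d)).1 h1))

/-- If `p ^ g - 1 = d * μ` with `g` the order of `p` modulo `d > 1`, then no `1 < σ ≤ μ` has the
property that its multiples `c * σ` with `p ∤ μ.choose c` avoid the interval `(μ, p ^ g)`. -/
theorem eq_one_of_choose_gap {p : ℕ} (hp : p.Prime) {g d μ σ : ℕ} (hd : 1 < d)
    (hμ : d * μ + 1 = p ^ g) (hmin : ∀ j, 0 < j → j < g → ¬ d ∣ p ^ j - 1)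
    (hσ : 0 < σ) (hσμ : σ ≤ μ)
    (H : ∀ c, ¬ p ∣ μ.choose c → c * σ < p ^ g → c * σ ≤ μ) : σ = 1 := by
  have hμ2 : 2 * μ < p ^ g := by nlinarith
  set N := Nat.log p σ with hN
  have hNσ : p ^ N ≤ σ := Nat.pow_log_le_self p hσ.ne'
  have hσN : σ < p ^ (N + 1) := Nat.lt_pow_succ_log_self hp.one_lt σ
  have hNg : N < g := (Nat.pow_lt_pow_iff_right hp.one_lt).1 (by omega)
  obtain ⟨K, rfl⟩ : ∃ K, g = N + (K + 1) := ⟨g - N - 1, by omega⟩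
  have hpμ : ¬ p ∣ μ := not_dvd_of_mul_add_one_eq_pow hp (by omega) hμ
  have hB : μ % p ^ (K + 1) ≠ 0 := fun h =>
    hpμ ((dvd_pow_self p (by omega)).trans (Nat.dvd_of_mod_eq_zero h))
  have hle := mul_mod_pow_le hp (σ := σ) (j := K + 1) hμ2 hB (by
    rw [show N + (K + 1) = (N + 1) + K by ring, pow_add, Nat.add_sub_cancel]
    exact Nat.mul_lt_mul_of_pos_right hσN (pow_pos hp.pos _)) H
  have hAB := Nat.div_add_mod μ (p ^ (K + 1))
  set A := μ / p ^ (K + 1) with hA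
  set B := μ % p ^ (K + 1) with hBdef
  have hAN : A < p ^ N := by
    rw [hA, Nat.div_lt_iff_lt_mul (pow_pos hp.pos _), ← pow_add]
    omega
  have hkey : p ^ N * μ = (d * A) * μ + (A + p ^ N * B) := by
    have : p ^ N * μ = p ^ (N + (K + 1)) * A + p ^ N * B := by
      rw [pow_add]; nth_rw 1 [← hAB]; ring
    rw [this, ← hμ]; ring
  have hNB : p ^ N * B ≤ μ := (Nat.mul_le_mul_right _ hNσ).trans (by linarith)
  have hNBpos : 0 < p ^ N * B := Nat.mul_pos (pow_pos hp.pos _) (Nat.pos_of_ne_zero hB)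
  have h1 : p ^ N < d * A + 2 := by
    by_contra! h
    have := Nat.mul_le_mul_right μ h
    nlinarith
  have h2 : d * A < p ^ N := by
    by_contra! h
    have := Nat.mul_le_mul_right μ h
    linarith
  have hN0 : N = 0 := by
    by_contra h
    exact hmin N (Nat.pos_of_ne_zero h) (by omega) ⟨A, by omega⟩
  have hA0 : A = 0 := by
    rw [hN0] at hAN; simpa using hAN
  have hBμ : B = μ := by rw [← hAB, hA0]; simp
  rw [hBμ] at hle
  nlinarith

open MvPolynomial in
/-- A polynomial in `x, x ^ Q, …, x ^ Q ^ (h - 1)` of degree less than `Q` in each variable is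
determined by its values on the field with `Q ^ h` elements. -/
theorem MvPolynomial.eq_zero_of_eval_frobenius_eq_zero {F : Type*} [Field F] [Fintype F]
    {Q h : ℕ} (hcard : Fintype.card F = Q ^ h) (P : MvPolynomial (Fin h) F)
    (hdeg : ∀ k, P.degreeOf k < Q)
    (hP : ∀ x : F, eval (fun k : Fin h => x ^ Q ^ (k : ℕ)) P = 0) : P = 0 := by
  classical
  have hlt {s : Fin h →₀ ℕ} (hs : s ∈ P.support) (k : Fin h) : s k < Q :=
    (monomial_le_degreeOf k hs).trans_lt (hdeg k)
  have hwt {s : Fin h →₀ ℕ} (hs : s ∈ P.support) :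
      ((finFunctionFinEquiv fun k => (⟨s k, hlt hs k⟩ : Fin Q)) : ℕ) = ∑ k, s k * Q ^ (k : ℕ) :=
    finFunctionFinEquiv_apply _
  let R : Polynomial F :=
    ∑ s ∈ P.support, Polynomial.monomial (∑ k, s k * Q ^ (k : ℕ)) (P.coeff s)
  have hR : R = 0 := by
    refine Polynomial.eq_zero_of_natDegree_lt_card_of_eval_eq_zero' R Finset.univ ?_ ?_
    · intro x _
      rw [← hP x, eval_eq', Polynomial.eval_finsetSum]
      refine Finset.sum_congr rfl fun s _ => ?_
      rw [Polynomial.eval_monomial, ← Finset.prod_pow_eq_pow_sum]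
      simp only [← pow_mul, mul_comm]
    · rw [Finset.card_univ, hcard]
      have hpos : 0 < Q ^ h := hcard ▸ Fintype.card_pos
      refine lt_of_le_of_lt (Polynomial.natDegree_sum_le_of_forall_le _ _ (n := Q ^ h - 1) ?_)
        (by omega)
      intro s hs
      refine (Polynomial.natDegree_monomial_le _).trans ?_
      rw [← hwt hs]
      have := (finFunctionFinEquiv fun k => (⟨s k, hlt hs k⟩ : Fin Q)).is_lt
      omega
  by_contra hne
  obtain ⟨s, hs⟩ := Finset.nonempty_iff_ne_empty.2 (mt support_eq_empty.1 hne)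
  have hcoeff := congrArg (Polynomial.coeff · (∑ k, s k * Q ^ (k : ℕ))) hR
  simp only [R, Polynomial.finsetSum_coeff, Polynomial.coeff_monomial, Polynomial.coeff_zero]
    at hcoeff
  rw [Finset.sum_eq_single_of_mem s hs, if_pos rfl] at hcoeff
  · exact mem_support_iff.1 hs hcoeff
  · intro s' hs' hss'
    refine if_neg fun heq => hss' ?_
    rw [← hwt hs, ← hwt hs'] at heq
    have hfun := finFunctionFinEquiv.injective (Fin.ext heq)
    ext k
    exact congrArg Fin.val (congrFun hfun k)

open MvPolynomial in
theorem linearIndependent_frobenius_monomials {F ι : Type*} [Field F] [Fintype F] [Fintype ι]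
    {Q h : ℕ} (hcard : Fintype.card F = Q ^ h) (e : ι → Fin h → ℕ) (he : Function.Injective e)
    (hlt : ∀ i k, e i k < Q) :
    LinearIndependent F (fun i (x : F) => ∏ k : Fin h, (x ^ Q ^ (k : ℕ)) ^ e i k) := by
  classical
  rw [Fintype.linearIndependent_iff]
  intro c hc
  let E : ι → Fin h →₀ ℕ := fun i => Finsupp.equivFunOnFinite.symm (e i)
  have hE : Function.Injective E := Finsupp.equivFunOnFinite.symm.injective.comp he
  have hcoeff (i : ι) : (∑ j, monomial (E j) (c j)).coeff (E i) = c i := by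
    simp [coeff_sum, coeff_monomial, hE.eq_iff]
  have hzero : ∑ i, monomial (E i) (c i) = 0 := by
    refine eq_zero_of_eval_frobenius_eq_zero hcard _ (fun k => ?_) fun x => ?_
    · have hQ : 0 < Q := by
        rcases Nat.eq_zero_or_pos Q with rfl | hQ
        · have : 0 < 0 ^ h := hcard ▸ Fintype.card_pos
          have hh : h ≠ 0 := fun h0 => (h0 ▸ k).elim0
          simp [hh] at this
        · exact hQ
      rw [degreeOf_lt_iff hQ]
      intro s hs
      obtain ⟨i, -, hi⟩ := Finset.mem_biUnion.1 (support_sum hs)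
      have := support_monomial_subset hi
      rw [Finset.mem_singleton.1 this]
      exact hlt i k
    · have := congrFun hc x
      simpa [eval_monomial, Finsupp.prod_fintype, E] using this
  intro i
  rw [← hcoeff i, hzero, coeff_zero]

/-- Two expressions of the same length for one bilinear kernel, the second with linearly independent
factors: the factors of the first lie in the span of those of the second. -/
theorem mem_span_of_sum_mul_eq_sum_mul {K X ι : Type*} [Field K] [Fintype ι] (c : ι → K)
    (hc : ∀ i, c i ≠ 0) (a b a' b' : ι → X → K) (ha' : LinearIndependent K a')
    (hb' : LinearIndependent K b')
    (h : ∀ u v, ∑ i, c i * (a i u * b i v) = ∑ i, c i * (a' i u * b' i v)) (i : ι) :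
    a i ∈ Submodule.span K (Set.range a') := by
  classical
  have hle : Submodule.span K (Set.range a') ≤ Submodule.span K (Set.range a) := by
    rw [Submodule.span_le]
    rintro _ ⟨j, rfl⟩
    obtain ⟨φ, hφ⟩ := LinearMap.exists_extend
      ((Finsupp.lapply j).comp hb'.repr : Submodule.span K (Set.range b') →ₗ[K] K)
    have hφb (l : ι) : φ (b' l) = if l = j then 1 else 0 := by
      have := LinearMap.congr_fun hφ ⟨b' l, Submodule.subset_span ⟨l, rfl⟩⟩
      simpa [hb'.repr_eq_single l, Finsupp.single_apply] using this
    have hsum : c j • a' j = ∑ l, (c l * φ (b l)) • a l := by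
      funext u
      have hu : ∑ l, (c l * a l u) • b l = ∑ l, (c l * a' l u) • b' l := by
        funext v
        simpa [mul_assoc] using h u v
      have := congrArg φ hu
      simp only [map_sum, map_smul, hφb, smul_eq_mul, mul_ite, mul_one, mul_zero,
        Finset.sum_ite_eq', Finset.mem_univ, if_true] at this
      simp only [Pi.smul_apply, Finset.sum_apply, smul_eq_mul, ← this]
      exact Finset.sum_congr rfl fun l _ => by ring
    refine (Submodule.smul_mem_iff _ (hc j)).1 (hsum ▸ Submodule.sum_mem _ fun l _ => ?_)
    exact Submodule.smul_mem _ _ (Submodule.subset_span ⟨l, rfl⟩)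
  have := FiniteDimensional.span_of_finite K (Set.finite_range a)
  rw [Submodule.eq_of_le_of_finrank_le hle
    ((finrank_range_le_card a).trans_eq (finrank_span_eq_card ha').symm)]
  exact Submodule.subset_span ⟨i, rfl⟩

theorem sub_pow_mul_sum_pow_eq {F : Type*} [Field F] {p : ℕ} [Fact p.Prime] [CharP F p]
    (g h μ : ℕ) (u v : F) :
    (u - v) ^ (μ * ∑ k : Fin h, (p ^ g) ^ (k : ℕ)) =
      ∑ s ∈ Fintype.piFinset (fun _ : Fin h => (Finset.range (μ + 1)).filter
        (¬ p ∣ μ.choose ·)), (∏ k, ((-1) ^ (μ - s k) * (μ.choose (s k) : F))) *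
          ((∏ k : Fin h, (u ^ (p ^ g) ^ (k : ℕ)) ^ s k) *
            ∏ k : Fin h, (v ^ (p ^ g) ^ (k : ℕ)) ^ (μ - s k)) := by
  have hfactor (k : ℕ) : ((u - v) ^ (p ^ g) ^ k) ^ μ =
      ∑ c ∈ (Finset.range (μ + 1)).filter (¬ p ∣ μ.choose ·), (-1) ^ (μ - c) *
        (μ.choose c : F) * ((u ^ (p ^ g) ^ k) ^ c * (v ^ (p ^ g) ^ k) ^ (μ - c)) := by
    rw [← pow_mul p, sub_pow_char_pow, sub_eq_add_neg, add_pow, Finset.sum_filter_of_ne]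
    · refine Finset.sum_congr rfl fun c _ => ?_
      rw [neg_pow (v ^ _)]
      ring
    · intro c _ hne hdvd
      exact hne (by simp [(CharP.cast_eq_zero_iff F p _).2 hdvd])
  rw [mul_comm, pow_mul, ← Finset.prod_pow_eq_pow_sum, ← Finset.prod_pow]
  simp only [hfactor, Finset.prod_univ_sum, Finset.prod_mul_distrib]

open MvPolynomial in
/-- The powers of `f` occurring in the expansion of `(f u - f v) ^ m` are combinations of the
powers of `x` occurring in the expansion of `(u - v) ^ m`. -/
theorem exists_mvPolynomial_eval_eq_prod_pow {F : Type*} [Field F] [Fintype F] {p : ℕ}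
    [Fact p.Prime] [CharP F p] {g h μ : ℕ} (hcard : Fintype.card F = (p ^ g) ^ h)
    (hμ : μ < p ^ g) {f : F → F}
    (hf : ∀ u v, (f u - f v) ^ (μ * ∑ k : Fin h, (p ^ g) ^ (k : ℕ)) =
      (u - v) ^ (μ * ∑ k : Fin h, (p ^ g) ^ (k : ℕ)))
    (s : Fin h → ℕ) (hs : ∀ k, ¬ p ∣ μ.choose (s k)) :
    ∃ P : MvPolynomial (Fin h) F, (∀ k, P.degreeOf k ≤ μ) ∧
      ∀ x, eval (fun k : Fin h => x ^ (p ^ g) ^ (k : ℕ)) P =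
        ∏ k : Fin h, (f x ^ (p ^ g) ^ (k : ℕ)) ^ s k := by
  classical
  set S := Fintype.piFinset (fun _ : Fin h => (Finset.range (μ + 1)).filter (¬ p ∣ μ.choose ·))
    with hS
  have hSmem {t : Fin h → ℕ} : t ∈ S ↔ ∀ k, t k ≤ μ ∧ ¬ p ∣ μ.choose (t k) := by
    simp [hS]
  have hsS : s ∈ S := hSmem.2 fun k => ⟨by
    by_contra! hlt
    exact hs k (by simp [Nat.choose_eq_zero_of_lt hlt]), hs k⟩
  have hspan := mem_span_of_sum_mul_eq_sum_mul
    (fun t : S => ∏ k, ((-1) ^ (μ - t.1 k) * (μ.choose (t.1 k) : F)))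
    (fun t => Finset.prod_ne_zero_iff.2 fun k _ => mul_ne_zero (pow_ne_zero _ (by simp))
      (mt (CharP.cast_eq_zero_iff F p _).1 (hSmem.1 t.2 k).2))
    (fun t x => ∏ k : Fin h, (f x ^ (p ^ g) ^ (k : ℕ)) ^ t.1 k)
    (fun t x => ∏ k : Fin h, (f x ^ (p ^ g) ^ (k : ℕ)) ^ (μ - t.1 k))
    (fun t x => ∏ k : Fin h, (x ^ (p ^ g) ^ (k : ℕ)) ^ t.1 k)
    (fun t x => ∏ k : Fin h, (x ^ (p ^ g) ^ (k : ℕ)) ^ (μ - t.1 k))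
    (linearIndependent_frobenius_monomials hcard _ Subtype.val_injective
      fun t k => ((hSmem.1 t.2 k).1).trans_lt hμ)
    (linearIndependent_frobenius_monomials hcard (fun (t : S) k => μ - t.1 k)
      (fun t t' htt' => Subtype.ext <| funext fun k => by
        have h1 := congrFun htt' k
        have h2 := (hSmem.1 t.2 k).1
        have h3 := (hSmem.1 t'.2 k).1
        simp only at h1
        omega)
      fun t k => (Nat.sub_le _ _).trans_lt hμ)
    (fun u v => by
      have := hf u v
      rw [sub_pow_mul_sum_pow_eq, sub_pow_mul_sum_pow_eq, ← hS, ← Finset.sum_coe_sort S,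
        ← Finset.sum_coe_sort S] at this
      exact this)
    ⟨s, hsS⟩
  obtain ⟨c, hc⟩ := (Submodule.mem_span_range_iff_exists_fun F).1 hspan
  refine ⟨∑ t : S, monomial (Finsupp.equivFunOnFinite.symm t.1) (c t), fun k => ?_, fun x => ?_⟩
  · refine (degreeOf_sum_le _ _ _).trans (Finset.sup_le fun t _ => ?_)
    refine degreeOf_le_iff.2 fun m hm => ?_
    rw [Finset.mem_singleton.1 (support_monomial_subset hm)]
    exact (hSmem.1 t.2 k).1
  · rw [← congrFun hc x]
    simp [eval_monomial, Finsupp.prod_fintype]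

open MvPolynomial in
theorem MvPolynomial.exists_degreeOf_ne_zero_of_eval_ne {F ι : Type*} [Field F] [Fintype ι]
    (P : MvPolynomial ι F) {y z : ι → F} (hyz : eval y P ≠ eval z P) :
    ∃ k, P.degreeOf k ≠ 0 := by
  by_contra! hall
  have hsupp : P.support ⊆ {0} := fun s hs => by
    rw [Finset.mem_singleton]
    ext k
    exact Nat.le_zero.1 ((monomial_le_degreeOf k hs).trans_eq (hall k))
  have hconst (w : ι → F) : eval w P = P.coeff 0 := by
    rw [eval_eq', Finset.sum_subset hsupp fun s _ hs => by simp [notMem_support_iff.1 hs]]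
    simp
  exact hyz ((hconst y).trans (hconst z).symm)

open MvPolynomial in
theorem MvPolynomial.exists_eval_eq_of_sum_degreeOf_le_one {F ι : Type*} [Field F] [Fintype ι]
    (P : MvPolynomial ι F) (hdeg : ∑ k, P.degreeOf k ≤ 1)
    (h0 : eval (fun _ => 0) P = 0) (h1 : eval (fun _ => 1) P = 1) :
    ∃ k, ∀ y, eval y P = y k := by
  classical
  obtain ⟨k, hk⟩ := exists_degreeOf_ne_zero_of_eval_ne P (y := fun _ => 0)
    (z := fun _ => 1) (by rw [h0, h1]; exact zero_ne_one)
  have hsupp : P.support ⊆ {0, Finsupp.single k 1} := fun s hs => by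
    rw [← Finset.add_sum_erase _ _ (Finset.mem_univ k)] at hdeg
    have hrest (j : ι) (hj : j ≠ k) : s j = 0 := by
      have h2 := Finset.single_le_sum (f := fun j => P.degreeOf j) (fun _ _ => Nat.zero_le _)
        (Finset.mem_erase.2 ⟨hj, Finset.mem_univ j⟩)
      have h3 := monomial_le_degreeOf j hs
      omega
    have hsk : s k ≤ 1 := (monomial_le_degreeOf k hs).trans (by omega)
    rw [Finset.mem_insert, Finset.mem_singleton]
    have hs' : s = Finsupp.single k (s k) := by
      ext j
      by_cases hj : j = k
      · simp [hj]
      · simp [hrest j hj, Ne.symm hj]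
    interval_cases hval : s k
    · left; simpa using hs'
    · right; exact hs'
  have heval (y : ι → F) : eval y P = P.coeff 0 + P.coeff (Finsupp.single k 1) * y k := by
    rw [eval_eq', Finset.sum_subset hsupp fun s _ hs => by simp [notMem_support_iff.1 hs],
      Finset.sum_pair (by simp [eq_comm])]
    simp [Finsupp.single_apply, Finset.prod_ite_eq]
  refine ⟨k, fun y => ?_⟩
  rw [heval] at h0 h1 ⊢
  simp only [mul_zero, add_zero] at h0
  simp only [h0, mul_one, zero_add] at h1
  rw [h0, h1, one_mul, zero_add]

open MvPolynomial in
theorem exists_eq_pow_of_sub_pow_eq {F : Type*} [Field F] [Fintype F] {p : ℕ}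
    [hp : Fact p.Prime] [CharP F p] {d g h μ : ℕ} (hcard : Fintype.card F = (p ^ g) ^ h)
    (hh : 0 < h) (hd : 1 < d) (hμ : d * μ + 1 = p ^ g)
    (hmin : ∀ j, 0 < j → j < g → ¬ d ∣ p ^ j - 1) {f : F → F} (f0 : f 0 = 0) (f1 : f 1 = 1)
    (hf : ∀ u v, (f u - f v) ^ (μ * ∑ k : Fin h, (p ^ g) ^ (k : ℕ)) =
      (u - v) ^ (μ * ∑ k : Fin h, (p ^ g) ^ (k : ℕ))) :
    ∃ k, ∀ x, f x = x ^ (p ^ g) ^ k := by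
  classical
  have hμ2 : 2 * μ < p ^ g := by nlinarith
  have hg : g ≠ 0 := by
    rintro rfl
    have := Fintype.one_lt_card (α := F)
    simp [hcard] at this
  have hpμ : ¬ p ∣ μ := not_dvd_of_mul_add_one_eq_pow hp.out hg hμ
  have good0 : ¬ p ∣ μ.choose 0 := by simpa using hp.out.one_lt.ne'
  have good1 : ¬ p ∣ μ.choose 1 := by simpa using hpμ
  have degree_le (s : Fin h → ℕ) (hs : ∀ k, ¬ p ∣ μ.choose (s k)) (P : MvPolynomial (Fin h) F)
      (hP : ∀ k, P.degreeOf k < p ^ g)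
      (hPf : ∀ x, eval (fun k : Fin h => x ^ (p ^ g) ^ (k : ℕ)) P =
        ∏ k : Fin h, (f x ^ (p ^ g) ^ (k : ℕ)) ^ s k) (k : Fin h) : P.degreeOf k ≤ μ := by
    obtain ⟨R, hR, hRf⟩ := exists_mvPolynomial_eval_eq_prod_pow hcard (by omega) hf s hs
    have hPR : P - R = 0 := eq_zero_of_eval_frobenius_eq_zero hcard _
      (fun k => (degreeOf_sub_le k P R).trans_lt (max_lt (hP k) ((hR k).trans_lt (by omega))))
      fun x => by rw [map_sub, hPf, hRf, sub_self]
    rw [sub_eq_zero.1 hPR]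
    exact hR k
  have hex (j : Fin h) : ∃ P : MvPolynomial (Fin h) F, (∀ k, P.degreeOf k ≤ μ) ∧
      ∀ x, eval (fun k : Fin h => x ^ (p ^ g) ^ (k : ℕ)) P = f x ^ (p ^ g) ^ (j : ℕ) := by
    obtain ⟨P, hP, hPf⟩ := exists_mvPolynomial_eval_eq_prod_pow hcard (by omega) hf
      (fun k => if k = j then 1 else 0) (fun k => by split_ifs <;> assumption)
    exact ⟨P, hP, fun x => by simp [hPf, pow_ite]⟩
  choose G hGdeg hGf using hex
  have hQpos : p ^ g ≠ 0 := (pow_pos hp.out.pos g).ne'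
  have hG0 (j : Fin h) : eval (fun _ => 0) (G j) = 0 := by
    simpa only [f0, zero_pow (pow_ne_zero _ hQpos)] using hGf j 0
  have hG1 (j : Fin h) : eval (fun _ => 1) (G j) = 1 := by
    simpa [f1] using hGf j 1
  have hGne (j : Fin h) : G j ≠ 0 := fun h0 => by simpa [h0] using hG1 j
  have hpartial (J : Finset (Fin h)) : ∀ k, ∑ j ∈ J, (G j).degreeOf k ≤ μ := by
    induction J using Finset.induction_on with
    | empty => simp
    | insert i J hi ih =>
      have hdeg (k : Fin h) := degreeOf_prod_eq (n := k) (insert i J) G fun j _ => hGne j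
      intro k
      rw [← hdeg]
      refine degree_le (fun k => if k ∈ insert i J then 1 else 0)
        (fun k => by split_ifs <;> assumption) _ (fun k => ?_) (fun x => ?_) k
      · rw [hdeg, Finset.sum_insert hi]
        have := ih k
        have := hGdeg i k
        omega
      · simp only [map_prod, hGf, pow_ite, pow_one, pow_zero]
        rw [Finset.prod_ite_mem, Finset.univ_inter]
  have hprod_ne : ∏ j, G j ≠ 0 := Finset.prod_ne_zero_iff.2 fun j _ => hGne j
  have hdegProd (k : Fin h) : (∏ j, G j).degreeOf k = ∑ j, (G j).degreeOf k :=
    degreeOf_prod_eq _ _ fun j _ => hGne j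
  have hGpos (j : Fin h) : 1 ≤ ∑ k, (G j).degreeOf k := by
    obtain ⟨k, hk⟩ := exists_degreeOf_ne_zero_of_eval_ne (G j) (y := fun _ => 0)
      (z := fun _ => 1) (by rw [hG0, hG1]; exact zero_ne_one)
    exact (Nat.one_le_iff_ne_zero.2 hk).trans
      (Finset.single_le_sum (f := fun k => (G j).degreeOf k) (fun _ _ => Nat.zero_le _)
        (Finset.mem_univ k))
  set σ := Finset.univ.sup fun k => (∏ j, G j).degreeOf k with hσ
  have hσk (k : Fin h) : ∑ j, (G j).degreeOf k ≤ σ :=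
    hdegProd k ▸ Finset.le_sup (f := fun k => (∏ j, G j).degreeOf k) (Finset.mem_univ k)
  have hσμ : σ ≤ μ := Finset.sup_le fun k _ => (hdegProd k).trans_le (hpartial _ k)
  have hσpos : 0 < σ := by
    by_contra! h0
    have hzero : ∑ k, (G ⟨0, hh⟩).degreeOf k = 0 := Finset.sum_eq_zero fun k _ => by
      have h2 := Finset.single_le_sum (f := fun j => (G j).degreeOf k)
        (fun _ _ => Nat.zero_le _) (Finset.mem_univ ⟨0, hh⟩)
      have h3 := hσk k
      omega
    have := hGpos ⟨0, hh⟩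
    omega
  have hσ1 : σ = 1 := by
    refine eq_one_of_choose_gap hp.out hd hμ hmin hσpos hσμ fun c hc hcσ => ?_
    obtain ⟨k, -, hk⟩ := Finset.exists_mem_eq_sup Finset.univ ⟨⟨0, hh⟩, Finset.mem_univ _⟩
      fun k => (∏ j, G j).degreeOf k
    rw [hσ, hk, ← degreeOf_pow_eq k _ c hprod_ne]
    refine degree_le (fun _ => c) (fun _ => hc) _ (fun k => ?_) (fun x => ?_) k
    · rw [degreeOf_pow_eq k _ c hprod_ne, hdegProd]
      exact (Nat.mul_le_mul_left c (hσk k)).trans_lt hcσ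
    · simp only [map_pow, map_prod, hGf, Finset.prod_pow]
  have hsum0 : ∑ k, (G ⟨0, hh⟩).degreeOf k ≤ 1 := by
    have htotal : ∑ j, ∑ k, (G j).degreeOf k ≤ h := by
      rw [Finset.sum_comm]
      refine (Finset.sum_le_card_nsmul _ _ 1 fun k _ => (hσk k).trans hσ1.le).trans ?_
      simp
    have hrest := Finset.card_nsmul_le_sum (Finset.univ.erase (⟨0, hh⟩ : Fin h))
      (fun j => ∑ k, (G j).degreeOf k) 1 fun j _ => hGpos j
    rw [← Finset.add_sum_erase _ _ (Finset.mem_univ (⟨0, hh⟩ : Fin h))] at htotal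
    simp only [Finset.card_erase_of_mem (Finset.mem_univ _), Finset.card_univ, Fintype.card_fin,
      smul_eq_mul, mul_one] at hrest
    omega
  obtain ⟨k, hk⟩ := exists_eval_eq_of_sum_degreeOf_le_one _ hsum0 (hG0 _) (hG1 _)
  refine ⟨k, fun x => ?_⟩
  have := hGf ⟨0, hh⟩ x
  rw [hk] at this
  simpa using this.symm

/-- McConnel's theorem: let `q = p^e` be a prime power, `d` a divisor of `q−1` with
`1 < d < q−1`, and `m = (q−1)/d`. A function `f : F_q → F_q` satisfies `f(0) = 0`,
`f(1) = 1` and `(f(u) − f(v))^m = (u − v)^m` for all `u, v` iff `f(x) = x^(p^j)` for some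
`j` with `d ∣ p^j − 1`. -/
theorem mcconnel_theorem {F : Type*} [Field F] [Fintype F]
    (p : ℕ) (hp : p.Prime) (hchar : ringChar F = p)
    (d : ℕ) (hd : d ∣ Fintype.card F - 1) (hd1 : 1 < d) (hd2 : d < Fintype.card F - 1)
    (f : F → F) :
    (f 0 = 0 ∧ f 1 = 1 ∧ ∀ u v : F,
        (f u - f v) ^ ((Fintype.card F - 1) / d) = (u - v) ^ ((Fintype.card F - 1) / d)) ↔
      ∃ j : ℕ, d ∣ p ^ j - 1 ∧ ∀ x : F, f x = x ^ p ^ j := by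
  have := Fact.mk hp
  have : CharP F p := hchar ▸ ringChar.charP F
  constructor
  · rintro ⟨f0, f1, hf⟩
    obtain ⟨e, -, hcard⟩ := FiniteField.card F p
    have hdvd_iff (j : ℕ) : d ∣ p ^ j - 1 ↔ orderOf (p : ZMod d) ∣ j := by
      rw [orderOf_dvd_iff_pow_eq_one, ← ZMod.natCast_eq_zero_iff,
        Nat.cast_sub (Nat.one_le_pow _ _ hp.pos), Nat.cast_pow, Nat.cast_one, sub_eq_zero]
    rw [hcard] at hd hf
    have hge := (hdvd_iff e).1 hd
    set g := orderOf (p : ZMod d) with hg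
    obtain ⟨h, hh⟩ := hge
    have hh0 : 0 < h := Nat.pos_of_ne_zero fun h0 => e.ne_zero (by simp [hh, h0])
    obtain ⟨μ, hμ⟩ := (hdvd_iff g).2 dvd_rfl
    have hQ : 1 ≤ p ^ g := Nat.one_le_pow _ _ hp.pos
    have hm : (p ^ (e : ℕ) - 1) / d = μ * ∑ k : Fin h, (p ^ g) ^ (k : ℕ) := by
      refine Nat.div_eq_of_eq_mul_right (by omega) ?_
      rw [hh, pow_mul, ← mul_assoc, ← hμ, Fin.sum_univ_eq_sum_range (fun k => (p ^ g) ^ k) h]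
      rw [mul_comm, geom_sum_mul_of_one_le hQ]
    rw [hm] at hf
    obtain ⟨k, hk⟩ := exists_eq_pow_of_sub_pow_eq (by rw [hcard, hh, pow_mul]) hh0 hd1
      (by omega) (fun j hj hjg hdj =>
        absurd (Nat.le_of_dvd hj ((hdvd_iff j).1 hdj)) (by omega)) f0 f1 hf
    exact ⟨g * k, (hdvd_iff _).2 (dvd_mul_right g k), fun x => by rw [hk, pow_mul p]⟩
  · rintro ⟨j, ⟨l, hl⟩, hf⟩
    have hpj : p ^ j = d * l + 1 := by
      have := Nat.one_le_pow j p hp.pos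
      omega
    refine ⟨by simp [hf, hp.ne_zero], by simp [hf], fun u v => ?_⟩
    rw [hf, hf, ← sub_pow_char_pow, pow_right_comm, hpj, pow_succ, pow_mul _ d,
      ← pow_mul _ _ d, Nat.div_mul_cancel hd]
    rcases eq_or_ne (u - v) 0 with h0 | h0
    · have : (Fintype.card F - 1) / d ≠ 0 := (Nat.div_pos hd2.le (by omega)).ne'
      simp [h0, this]
    · rw [FiniteField.pow_card_sub_one_eq_one _ h0, one_pow, one_mul]
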